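/- Let q ∈ L¹(0,π) be real-valued and let f be a rational Herglotz–Nevanlinna function. Suppose Λ̃ is an enumeration of the eigenvalues of the symmetric problem P̃(q,f), Λ_∞ is an enumeration of the eigenvalues of P(q,f,∞), and Λ_0 is an enumeration of the eigenvalues of P(q,f,0). Then for every k ∈ ℕ, Λ̃(2k+1) = Λ_∞(k) and Λ̃(2k) = Λ_0(k); that is, the odd-indexed and even-indexed eigenvalues of the symmetric problem coincide with the eigenvalues of P(q,f,∞) and of P(q,f,0), respectively. -/

import Mathlib

open MeasureTheory Set

noncomputable section

/-- A rational Herglotz–Nevanlinna function, given by its canonical data: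
`f(λ) = a·λ + c + Σ_j γ_j / (β_j − λ)` with `a ≥ 0`, `γ_j > 0` and `β_1 < … < β_n`. -/
structure RatHN where
  a : ℝ
  c : ℝ
  n : ℕ
  γ : Fin n → ℝ
  β : Fin n → ℝ
  ha : 0 ≤ a
  hγ : ∀ j, 0 < γ j
  hβ : StrictMono β

namespace RatHN

/-- The value `f(λ)` of a rational Herglotz–Nevanlinna function. -/
def eval (f : RatHN) (lam : ℝ) : ℝ :=
  f.a * lam + f.c + ∑ j : Fin f.n, f.γ j / (f.β j - lam)

/-- `lam` is a pole of `f`. -/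
def IsPole (f : RatHN) (lam : ℝ) : Prop := ∃ j, f.β j = lam

end RatHN

/-- A (Carathéodory) solution of `−y″ + Q·y = λ·y` on `[0, L]`:
a pair of continuous functions `y, y'` satisfying the two integral equations. -/
def IsCaraSol (Q : ℝ → ℝ) (L lam : ℝ) (y y' : ℝ → ℝ) : Prop :=
  ContinuousOn y (Icc 0 L) ∧ ContinuousOn y' (Icc 0 L) ∧
  (∀ x ∈ Icc (0:ℝ) L, y x = y 0 + ∫ t in (0:ℝ)..x, y' t) ∧
  (∀ x ∈ Icc (0:ℝ) L, y' x = y' 0 + ∫ t in (0:ℝ)..x, (Q t - lam) * y t)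

/-- `lam` is an eigenvalue of the problem `P(q, f, b)`, where `b : Option ℝ`
and `none` stands for the Dirichlet condition (`b = ∞`) at the right endpoint. -/
def IsEigen (q : ℝ → ℝ) (f : RatHN) (b : Option ℝ) (lam : ℝ) : Prop :=
  ∃ y y' : ℝ → ℝ, IsCaraSol q Real.pi lam y y' ∧
    (∃ x ∈ Icc (0:ℝ) Real.pi, y x ≠ 0) ∧
    (¬ f.IsPole lam → y' 0 = -f.eval lam * y 0) ∧
    (f.IsPole lam → y 0 = 0) ∧
    (∀ bb : ℝ, b = some bb → y' Real.pi = bb * y Real.pi) ∧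
    (b = none → y Real.pi = 0)

/-- The set of eigenvalues of the problem `P(q, f, b)`. -/
def eigenvalues (q : ℝ → ℝ) (f : RatHN) (b : Option ℝ) : Set ℝ :=
  {lam | IsEigen q f b lam}

/-- `Λ` is an enumeration of the set `S`: a strictly increasing sequence whose
range is exactly `S`. -/
def IsEnum (S : Set ℝ) (Λ : ℕ → ℝ) : Prop :=
  StrictMono Λ ∧ Set.range Λ = S

/-- The symmetric continuation of `q` from `(0, π)` to `(0, 2π)`. -/
def qSym (q : ℝ → ℝ) : ℝ → ℝ :=
  fun x => if x ≤ Real.pi then q x else q (2 * Real.pi - x)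

/-- `lam` is an eigenvalue of the symmetric problem `P̃(q, f)` on `[0, 2π]`. -/
def IsEigenSym (q : ℝ → ℝ) (f : RatHN) (lam : ℝ) : Prop :=
  ∃ y y' : ℝ → ℝ, IsCaraSol (qSym q) (2 * Real.pi) lam y y' ∧
    (∃ x ∈ Icc (0:ℝ) (2 * Real.pi), y x ≠ 0) ∧
    (¬ f.IsPole lam →
      y' 0 = -f.eval lam * y 0 ∧ y' (2 * Real.pi) = f.eval lam * y (2 * Real.pi)) ∧
    (f.IsPole lam → y 0 = 0 ∧ y (2 * Real.pi) = 0)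

theorem mul_eq_add_integral_of_primitives {F G f g : ℝ → ℝ} {L : ℝ}
    (hf : IntervalIntegrable f volume 0 L) (hg : IntervalIntegrable g volume 0 L)
    (hF : ∀ x ∈ Icc 0 L, F x = F 0 + ∫ t in (0:ℝ)..x, f t)
    (hG : ∀ x ∈ Icc 0 L, G x = G 0 + ∫ t in (0:ℝ)..x, g t) {x : ℝ} (hx : x ∈ Icc 0 L) :
    F x * G x = F 0 * G 0 + ∫ t in (0:ℝ)..x, (f t * G t + F t * g t) := by
  have hsub : uIcc 0 x ⊆ uIcc 0 L := by
    rw [uIcc_of_le hx.1, uIcc_of_le (hx.1.trans hx.2)]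
    exact Icc_subset_Icc_right hx.2
  have hf' := hf.mono_set hsub
  have hg' := hg.mono_set hsub
  have hac : ∀ (c : ℝ) {h : ℝ → ℝ}, IntervalIntegrable h volume 0 x →
      AbsolutelyContinuousOnInterval (fun y => c + ∫ t in (0:ℝ)..y, h t) 0 x := fun c h hh =>
    (LipschitzWith.const c).lipschitzOnWith.absolutelyContinuousOnInterval.add
      (hh.absolutelyContinuousOnInterval_intervalIntegral left_mem_uIcc)
  have key := (hac (F 0) hf').integral_deriv_mul_eq_sub (hac (G 0) hg')
  rw [← hF x hx, ← hG x hx] at key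
  simp only [intervalIntegral.integral_same, add_zero] at key
  rw [← sub_eq_iff_eq_add', ← key]
  refine intervalIntegral.integral_congr_ae ?_
  filter_upwards [hf'.ae_hasDerivAt_integral, hg'.ae_hasDerivAt_integral] with t h₁ h₂ ht
  have ht' : t ∈ uIcc 0 x := uIoc_subset_uIcc ht
  have htL : t ∈ Icc 0 L := by
    rw [← uIcc_of_le (hx.1.trans hx.2)]
    exact hsub ht'
  rw [((h₁ ht' 0 left_mem_uIcc).const_add (F 0)).deriv,
    ((h₂ ht' 0 left_mem_uIcc).const_add (G 0)).deriv, ← hF t htL, ← hG t htL]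

theorem pow_eq_integral_of_primitive {g : ℝ → ℝ} {L : ℝ} (hg : IntervalIntegrable g volume 0 L)
    (n : ℕ) {x : ℝ} (hx : x ∈ Icc 0 L) :
    (∫ s in (0:ℝ)..x, g s) ^ (n + 1) =
      ∫ t in (0:ℝ)..x, (n + 1) * (g t * (∫ s in (0:ℝ)..t, g s) ^ n) := by
  induction n generalizing x with
  | zero => simp
  | succ n ih =>
    have h0L : (0:ℝ) ≤ L := hx.1.trans hx.2
    have hcont : ContinuousOn (fun t => (∫ s in (0:ℝ)..t, g s) ^ n) (uIcc 0 L) :=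
      (hg.absolutelyContinuousOnInterval_intervalIntegral left_mem_uIcc).continuousOn.pow n
    have key := mul_eq_add_integral_of_primitives
      (F := fun x => (∫ s in (0:ℝ)..x, g s) ^ (n + 1)) (G := fun x => ∫ s in (0:ℝ)..x, g s)
      ((hg.mul_continuousOn hcont).const_mul (n + 1 : ℝ)) hg
      (fun y hy => by simp [ih hy]) (fun y hy => by simp) hx
    rw [pow_succ, key]
    simp only [intervalIntegral.integral_same, mul_zero, zero_add]
    refine intervalIntegral.integral_congr fun t _ => ?_
    push_cast
    ring

section Volterra

variable {L : ℝ} (hL : 0 ≤ L)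

theorem abs_IccExtend_le (u : C(Icc (0:ℝ) L, ℝ)) (t : ℝ) : |IccExtend hL u t| ≤ ‖u‖ :=
  u.norm_coe_le_norm _

theorem continuous_IccExtend_coe (u : C(Icc (0:ℝ) L, ℝ)) : Continuous (IccExtend hL u) :=
  u.continuous.Icc_extend'

theorem intervalIntegrable_mul_IccExtend {h : ℝ → ℝ} (hh : IntervalIntegrable h volume 0 L)
    (u : C(Icc (0:ℝ) L, ℝ)) {x : ℝ} (hx : x ∈ Icc 0 L) :
    IntervalIntegrable (fun t => h t * IccExtend hL u t) volume 0 x := by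
  refine (hh.mul_continuousOn (continuous_IccExtend_coe hL u).continuousOn).mono_set ?_
  rw [uIcc_of_le hx.1, uIcc_of_le hL]
  exact Icc_subset_Icc_right hx.2

/-- The operator `u ↦ (x ↦ ∫₀ˣ h u)` on continuous functions on `[0, L]`. -/
def volterra (h : ℝ → ℝ) (hh : IntervalIntegrable h volume 0 L) :
    C(Icc (0:ℝ) L, ℝ) →L[ℝ] C(Icc (0:ℝ) L, ℝ) :=
  LinearMap.mkContinuous
    { toFun := fun u =>
        { toFun := fun x => ∫ t in (0:ℝ)..x, h t * IccExtend hL u t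
          continuous_toFun := by
            have h₁ := ((intervalIntegrable_mul_IccExtend hL hh u
              (right_mem_Icc.2 hL)).absolutelyContinuousOnInterval_intervalIntegral
                left_mem_uIcc).continuousOn
            rw [uIcc_of_le hL] at h₁
            exact h₁.comp_continuous continuous_subtype_val Subtype.prop }
      map_add' := fun u v => by
        ext x
        simp only [ContinuousMap.coe_mk, ContinuousMap.add_apply]
        rw [← intervalIntegral.integral_add (intervalIntegrable_mul_IccExtend hL hh u x.2)
          (intervalIntegrable_mul_IccExtend hL hh v x.2)]
        refine intervalIntegral.integral_congr fun t _ => ?_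
        simp only [IccExtend_apply, ContinuousMap.add_apply, mul_add]
      map_smul' := fun c u => by
        ext x
        simp only [ContinuousMap.coe_mk, ContinuousMap.smul_apply, RingHom.id_apply, smul_eq_mul]
        rw [← intervalIntegral.integral_const_mul]
        refine intervalIntegral.integral_congr fun t _ => ?_
        simp only [IccExtend_apply, ContinuousMap.smul_apply, smul_eq_mul]
        ring }
    (∫ t in (0:ℝ)..L, |h t|) fun u => by
      have hM : 0 ≤ ∫ t in (0:ℝ)..L, |h t| :=
        intervalIntegral.integral_nonneg hL fun t _ => abs_nonneg _
      refine (ContinuousMap.norm_le _ (mul_nonneg hM (norm_nonneg _))).2 fun x => ?_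
      have hx := x.2
      have hsub : uIcc 0 (x:ℝ) ⊆ uIcc 0 L := by
        rw [uIcc_of_le hx.1, uIcc_of_le hL]
        exact Icc_subset_Icc_right hx.2
      calc ‖∫ t in (0:ℝ)..x, h t * IccExtend hL u t‖
          ≤ ∫ t in (0:ℝ)..x, |h t| * ‖u‖ := by
            refine intervalIntegral.norm_integral_le_of_norm_le hx.1 (ae_of_all _ fun t _ => ?_)
              ((hh.abs.mono_set hsub).mul_const _)
            rw [norm_mul]
            exact mul_le_mul_of_nonneg_left (abs_IccExtend_le hL u t) (norm_nonneg _)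
        _ = (∫ t in (0:ℝ)..x, |h t|) * ‖u‖ := intervalIntegral.integral_mul_const _ _
        _ ≤ (∫ t in (0:ℝ)..L, |h t|) * ‖u‖ := by
            refine mul_le_mul_of_nonneg_right ?_ (norm_nonneg _)
            exact intervalIntegral.integral_mono_interval le_rfl hx.1 hx.2
              (ae_of_all _ fun t => abs_nonneg _) hh.abs

@[simp]
theorem volterra_apply {h : ℝ → ℝ} (hh : IntervalIntegrable h volume 0 L)
    (u : C(Icc (0:ℝ) L, ℝ)) (x : Icc (0:ℝ) L) :
    volterra hL h hh u x = ∫ t in (0:ℝ)..x, h t * IccExtend hL u t :=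
  rfl

theorem abs_volterra_apply_le {h g : ℝ → ℝ} (hh : IntervalIntegrable h volume 0 L)
    (hg : IntervalIntegrable g volume 0 L) (hhg : ∀ t, |h t| ≤ g t) {C : ℝ} {n : ℕ}
    {u : C(Icc (0:ℝ) L, ℝ)}
    (hu : ∀ x : Icc (0:ℝ) L, |u x| ≤ C * ((∫ s in (0:ℝ)..x, g s) ^ n / n.factorial))
    (x : Icc (0:ℝ) L) :
    |volterra hL h hh u x| ≤
      C * ((∫ s in (0:ℝ)..x, g s) ^ (n + 1) / (n + 1).factorial) := by
  have hx := x.2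
  have hsub : uIcc 0 (x:ℝ) ⊆ uIcc 0 L := by
    rw [uIcc_of_le hx.1, uIcc_of_le hL]
    exact Icc_subset_Icc_right hx.2
  have hcont : ContinuousOn (fun t => C * ((∫ s in (0:ℝ)..t, g s) ^ n / n.factorial))
      (uIcc 0 L) :=
    (((hg.absolutelyContinuousOnInterval_intervalIntegral left_mem_uIcc).continuousOn.pow
      n).div_const _).const_mul C
  calc |volterra hL h hh u x|
      = ‖∫ t in (0:ℝ)..x, h t * IccExtend hL u t‖ := rfl
    _ ≤ ∫ t in (0:ℝ)..x, g t * (C * ((∫ s in (0:ℝ)..t, g s) ^ n / n.factorial)) := by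
        refine intervalIntegral.norm_integral_le_of_norm_le hx.1 (ae_of_all _ fun t ht => ?_)
          ((hg.mul_continuousOn hcont).mono_set hsub)
        rw [norm_mul]
        have htL : t ∈ Icc 0 L := ⟨ht.1.le, ht.2.trans hx.2⟩
        have hut : ‖IccExtend hL u t‖ ≤
            C * ((∫ s in (0:ℝ)..t, g s) ^ n / n.factorial) := by
          rw [IccExtend_of_mem hL _ htL]
          exact hu ⟨t, htL⟩
        exact mul_le_mul (hhg t) hut (norm_nonneg _) ((abs_nonneg _).trans (hhg t))
    _ = C * ((∫ s in (0:ℝ)..x, g s) ^ (n + 1) / (n + 1).factorial) := by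
        rw [pow_eq_integral_of_primitive hg n hx, ← intervalIntegral.integral_div,
          ← intervalIntegral.integral_const_mul]
        refine intervalIntegral.integral_congr fun t _ => ?_
        rw [Nat.factorial_succ]
        push_cast
        field_simp

theorem isUnit_one_sub_volterra_mul_volterra {h k : ℝ → ℝ}
    (hh : IntervalIntegrable h volume 0 L) (hk : IntervalIntegrable k volume 0 L) :
    IsUnit (1 - volterra hL h hh * volterra hL k hk) := by
  set W := volterra hL h hh * volterra hL k hk with hW
  have hg : IntervalIntegrable (fun t => |h t| + |k t|) volume 0 L := hh.abs.add hk.abs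
  set G : ℝ := ∫ s in (0:ℝ)..L, (|h s| + |k s|) with hG
  have hpow : ∀ (n : ℕ) (u : C(Icc (0:ℝ) L, ℝ)) (x : Icc (0:ℝ) L), |(W ^ n) u x| ≤
      ‖u‖ * ((∫ s in (0:ℝ)..x, (|h s| + |k s|)) ^ (2 * n) / (2 * n).factorial) := by
    intro n u
    induction n with
    | zero => intro x; simpa using! u.norm_coe_le_norm x
    | succ n ih =>
      rw [pow_succ', mul_add, mul_one]
      exact abs_volterra_apply_le hL hh hg (fun t => by linarith [abs_nonneg (k t)])
        (abs_volterra_apply_le hL hk hg (fun t => by linarith [abs_nonneg (h t)]) ih)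
  have hnorm : ∀ n : ℕ, ‖W ^ n‖ ≤ G ^ (2 * n) / (2 * n).factorial := by
    intro n
    have hG0 : 0 ≤ G := intervalIntegral.integral_nonneg hL fun t _ => by positivity
    refine ContinuousLinearMap.opNorm_le_bound _ (by positivity) fun u => ?_
    refine (ContinuousMap.norm_le _ (by positivity)).2 fun x => (hpow n u x).trans ?_
    rw [mul_comm]
    have hx0 : 0 ≤ ∫ s in (0:ℝ)..x, (|h s| + |k s|) :=
      intervalIntegral.integral_nonneg x.2.1 fun t _ => by positivity
    have hxG : ∫ s in (0:ℝ)..x, (|h s| + |k s|) ≤ G :=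
      intervalIntegral.integral_mono_interval le_rfl x.2.1 x.2.2
        (ae_of_all _ fun t => by positivity) hg
    gcongr
  have htend := (FloorSemiring.tendsto_pow_div_factorial_atTop G).comp
    (Filter.tendsto_id.const_mul_atTop' (zero_lt_two : 0 < 2))
  obtain ⟨n, hn⟩ := (htend.eventually (gt_mem_nhds one_pos)).exists
  have hunit : IsUnit (1 - W ^ n) := isUnit_one_sub_of_norm_lt_one
    (R := C(Icc (0:ℝ) L, ℝ) →L[ℝ] C(Icc (0:ℝ) L, ℝ)) ((hnorm n).trans_lt hn)
  have hcomm : Commute (1 - W) (∑ i ∈ Finset.range n, W ^ i) := by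
    rw [Commute, SemiconjBy, mul_neg_geom_sum, geom_sum_mul_neg]
  rw [← mul_neg_geom_sum] at hunit
  exact (hcomm.isUnit_mul_iff.1 hunit).1

end Volterra

section InitialValueProblem

variable {q : ℝ → ℝ} {L : ℝ}

namespace IsCaraSol

variable {lam mu : ℝ} {y y' z z' : ℝ → ℝ}

theorem continuousOn_uIcc (hL : 0 ≤ L) (h : IsCaraSol q L lam y y') :
    ContinuousOn y (uIcc 0 L) := by
  rw [uIcc_of_le hL]
  exact h.1

theorem continuousOn_uIcc_deriv (hL : 0 ≤ L) (h : IsCaraSol q L lam y y') :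
    ContinuousOn y' (uIcc 0 L) := by
  rw [uIcc_of_le hL]
  exact h.2.1

theorem intervalIntegrable_mul (hL : 0 ≤ L) (hq : IntervalIntegrable q volume 0 L)
    (h : IsCaraSol q L lam y y') :
    IntervalIntegrable (fun t => (q t - lam) * y t) volume 0 L :=
  (hq.sub intervalIntegrable_const).mul_continuousOn (h.continuousOn_uIcc hL)

theorem sub_const_mul (hq : IntervalIntegrable q volume 0 L)
    (hy : IsCaraSol q L lam y y') (hz : IsCaraSol q L lam z z') (c : ℝ) :
    IsCaraSol q L lam (fun x => y x - c * z x) (fun x => y' x - c * z' x) := by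
  refine ⟨hy.1.sub (hz.1.const_mul c), hy.2.1.sub (hz.2.1.const_mul c),
    fun x hx => ?_, fun x hx => ?_⟩
  all_goals
    have hL : 0 ≤ L := hx.1.trans hx.2
    have hsub : uIcc 0 x ⊆ uIcc 0 L := by
      rw [uIcc_of_le hx.1, uIcc_of_le hL]
      exact Icc_subset_Icc_right hx.2
  · rw [intervalIntegral.integral_sub, intervalIntegral.integral_const_mul]
    · linear_combination hy.2.2.1 x hx - c * hz.2.2.1 x hx
    · exact ((hy.continuousOn_uIcc_deriv hL).mono hsub).intervalIntegrable
    · exact (((hz.continuousOn_uIcc_deriv hL).mono hsub).intervalIntegrable).const_mul c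
  · have hsplit : ∫ t in (0:ℝ)..x, (q t - lam) * (y t - c * z t) =
        (∫ t in (0:ℝ)..x, (q t - lam) * y t) - c * ∫ t in (0:ℝ)..x, (q t - lam) * z t := by
      rw [← intervalIntegral.integral_const_mul, ← intervalIntegral.integral_sub]
      · exact intervalIntegral.integral_congr fun t _ => by ring
      · exact (hy.intervalIntegrable_mul hL hq).mono_set hsub
      · exact ((hz.intervalIntegrable_mul hL hq).mono_set hsub).const_mul c
    rw [hsplit]
    linear_combination hy.2.2.2 x hx - c * hz.2.2.2 x hx

/-- Lagrange's identity. -/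
theorem wronskian_eq (hL : 0 ≤ L) (hq : IntervalIntegrable q volume 0 L)
    (hy : IsCaraSol q L lam y y') (hz : IsCaraSol q L mu z z') :
    y L * z' L - y' L * z L =
      y 0 * z' 0 - y' 0 * z 0 + (lam - mu) * ∫ t in (0:ℝ)..L, y t * z t := by
  have hyc := hy.continuousOn_uIcc hL
  have hzc := hz.continuousOn_uIcc hL
  have hyc' := hy.continuousOn_uIcc_deriv hL
  have hzc' := hz.continuousOn_uIcc_deriv hL
  have hyq := hy.intervalIntegrable_mul hL hq
  have hzq := hz.intervalIntegrable_mul hL hq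
  have h₁ := mul_eq_add_integral_of_primitives hyc'.intervalIntegrable hzq hy.2.2.1 hz.2.2.2
    (right_mem_Icc.2 hL)
  have h₂ := mul_eq_add_integral_of_primitives hyq hzc'.intervalIntegrable hy.2.2.2 hz.2.2.1
    (right_mem_Icc.2 hL)
  have h₃ : (∫ t in (0:ℝ)..L, (y' t * z' t + y t * ((q t - mu) * z t))) -
      ∫ t in (0:ℝ)..L, ((q t - lam) * y t * z t + y' t * z' t) =
        (lam - mu) * ∫ t in (0:ℝ)..L, y t * z t := by
    rw [← intervalIntegral.integral_sub, ← intervalIntegral.integral_const_mul]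
    · exact intervalIntegral.integral_congr fun t _ => by ring
    · exact (hyc'.mul hzc').intervalIntegrable.add (hzq.continuousOn_mul hyc)
    · exact (hyq.mul_continuousOn hzc).add (hyc'.mul hzc').intervalIntegrable
  rw [h₁, h₂, ← h₃]
  ring

end IsCaraSol

theorem volterra_sub_const (hL : 0 ≤ L) (hq : IntervalIntegrable q volume 0 L) (lam : ℝ) :
    volterra hL (fun t => q t - lam) (hq.sub intervalIntegrable_const) =
      volterra hL q hq - lam • volterra hL (fun _ => 1) intervalIntegrable_const := by
  ext u x
  change ∫ t in (0:ℝ)..x, (q t - lam) * IccExtend hL u t =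
    (∫ t in (0:ℝ)..x, q t * IccExtend hL u t) - lam * ∫ t in (0:ℝ)..x, 1 * IccExtend hL u t
  rw [← intervalIntegral.integral_const_mul, ← intervalIntegral.integral_sub]
  · exact intervalIntegral.integral_congr fun t _ => by ring
  · exact intervalIntegrable_mul_IccExtend hL hq u x.2
  · exact (intervalIntegrable_mul_IccExtend hL intervalIntegrable_const u x.2).const_mul lam

theorem isCaraSol_IccExtend (hL : 0 ≤ L) (hq : IntervalIntegrable q volume 0 L) {lam A B : ℝ}
    {Y Y' : C(Icc (0:ℝ) L, ℝ)}
    (hY : Y = A • 1 + volterra hL (fun _ => 1) intervalIntegrable_const Y')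
    (hY' : Y' = B • 1 + volterra hL (fun t => q t - lam) (hq.sub intervalIntegrable_const) Y) :
    IsCaraSol q L lam (IccExtend hL Y) (IccExtend hL Y') ∧
      IccExtend hL Y 0 = A ∧ IccExtend hL Y' 0 = B := by
  have h₁ : ∀ x ∈ Icc 0 L, IccExtend hL Y x = A + ∫ t in (0:ℝ)..x, IccExtend hL Y' t := by
    intro x hx
    rw [IccExtend_of_mem hL _ hx, hY]
    simp
  have h₂ : ∀ x ∈ Icc 0 L, IccExtend hL Y' x =
      B + ∫ t in (0:ℝ)..x, (q t - lam) * IccExtend hL Y t := by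
    intro x hx
    rw [IccExtend_of_mem hL _ hx, hY']
    simp
  have h₁0 : IccExtend hL Y 0 = A := by simpa using h₁ 0 (left_mem_Icc.2 hL)
  have h₂0 : IccExtend hL Y' 0 = B := by simpa using h₂ 0 (left_mem_Icc.2 hL)
  refine ⟨⟨(continuous_IccExtend_coe hL Y).continuousOn,
    (continuous_IccExtend_coe hL Y').continuousOn, ?_, ?_⟩, h₁0, h₂0⟩
  · rwa [h₁0]
  · rwa [h₂0]

/-- Solutions whose initial data depend continuously on the spectral parameter. -/
theorem exists_isCaraSol_family (hL : 0 ≤ L) (hq : IntervalIntegrable q volume 0 L)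
    {A B : ℝ → ℝ} (hA : Continuous A) (hB : Continuous B) :
    ∃ Y Y' : ℝ → C(Icc (0:ℝ) L, ℝ), Continuous Y ∧ Continuous Y' ∧
      ∀ lam, IsCaraSol q L lam (IccExtend hL (Y lam)) (IccExtend hL (Y' lam)) ∧
        IccExtend hL (Y lam) 0 = A lam ∧ IccExtend hL (Y' lam) 0 = B lam := by
  set J := volterra hL (fun _ => 1) intervalIntegrable_const with hJ
  set V : ℝ → C(Icc (0:ℝ) L, ℝ) →L[ℝ] C(Icc (0:ℝ) L, ℝ) :=
    fun lam => volterra hL q hq - lam • J with hV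
  have hVcont : Continuous V := by fun_prop
  have hunit : ∀ lam, IsUnit (1 - J * V lam) := fun lam => by
    simp only [hV, hJ, ← volterra_sub_const]
    exact isUnit_one_sub_volterra_mul_volterra hL _ _
  have hinv : Continuous fun lam => Ring.inverse (1 - J * V lam) := by
    refine continuous_iff_continuousAt.2 fun lam => ?_
    obtain ⟨u, hu⟩ := hunit lam
    have h := NormedRing.inverse_continuousAt
      (R := C(Icc (0:ℝ) L, ℝ) →L[ℝ] C(Icc (0:ℝ) L, ℝ)) u
    rw [hu] at h
    exact h.comp (f := fun lam => 1 - J * V lam)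
      (continuous_const.sub (continuous_const.clm_comp hVcont)).continuousAt
  set Y : ℝ → C(Icc (0:ℝ) L, ℝ) := fun lam =>
    Ring.inverse (1 - J * V lam) (A lam • 1 + B lam • J 1) with hY
  have hYcont : Continuous Y := by fun_prop
  refine ⟨Y, fun lam => B lam • 1 + V lam (Y lam), hYcont, by fun_prop, fun lam => ?_⟩
  refine isCaraSol_IccExtend hL hq ?_ ?_
  · have h : (1 - J * V lam) (Y lam) = A lam • 1 + B lam • J 1 := by
      change ((1 - J * V lam) * Ring.inverse (1 - J * V lam)) _ = _
      rw [Ring.mul_inverse_cancel _ (hunit lam)]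
      rfl
    have h' : Y lam - J (V lam (Y lam)) = A lam • 1 + B lam • J 1 := h
    rw [map_add, map_smul, ← add_assoc, ← h']
    abel
  · rw [volterra_sub_const]

theorem IsCaraSol.eq_zero (hL : 0 ≤ L) (hq : IntervalIntegrable q volume 0 L) {lam : ℝ}
    {y y' : ℝ → ℝ} (h : IsCaraSol q L lam y y') (hy : y 0 = 0) (hy' : y' 0 = 0) {x : ℝ}
    (hx : x ∈ Icc 0 L) : y x = 0 ∧ y' x = 0 := by
  set J := volterra hL (fun _ => 1) intervalIntegrable_const with hJ
  set V := volterra hL (fun t => q t - lam) (hq.sub intervalIntegrable_const) with hV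
  let u : C(Icc (0:ℝ) L, ℝ) :=
    ⟨fun x => y x, h.1.comp_continuous continuous_subtype_val Subtype.prop⟩
  let u' : C(Icc (0:ℝ) L, ℝ) :=
    ⟨fun x => y' x, h.2.1.comp_continuous continuous_subtype_val Subtype.prop⟩
  have hext : ∀ (x : Icc (0:ℝ) L), ∀ t ∈ uIcc 0 (x:ℝ),
      IccExtend hL u t = y t ∧ IccExtend hL u' t = y' t := by
    intro x t ht
    rw [uIcc_of_le x.2.1] at ht
    have htL : t ∈ Icc 0 L := ⟨ht.1, ht.2.trans x.2.2⟩
    rw [IccExtend_of_mem hL _ htL, IccExtend_of_mem hL _ htL]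
    exact ⟨rfl, rfl⟩
  have h₁ : u = J u' := by
    ext x
    rw [hJ, volterra_apply]
    change y x = _
    rw [h.2.2.1 x x.2, hy, zero_add]
    exact intervalIntegral.integral_congr fun t ht => by simp [(hext x t ht).2]
  have h₂ : u' = V u := by
    ext x
    rw [hV, volterra_apply]
    change y' x = _
    rw [h.2.2.2 x x.2, hy', zero_add]
    exact intervalIntegral.integral_congr fun t ht => by simp [(hext x t ht).1]
  have hunit : IsUnit (1 - J * V) := isUnit_one_sub_volterra_mul_volterra hL _ _
  have h₃ : (1 - J * V) u = 0 := by
    change u - J (V u) = 0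
    rw [← h₂, ← h₁, sub_self]
  have h₄ : u = 0 := by
    have : (Ring.inverse (1 - J * V) * (1 - J * V)) u = 0 := by
      change Ring.inverse (1 - J * V) ((1 - J * V) u) = 0
      rw [h₃, map_zero]
    rwa [Ring.inverse_mul_cancel _ hunit] at this
  have h₅ : u' = 0 := by rw [h₂, h₄, map_zero]
  exact ⟨DFunLike.congr_fun h₄ ⟨x, hx⟩, DFunLike.congr_fun h₅ ⟨x, hx⟩⟩

theorem IsCaraSol.eq_const_mul (hL : 0 ≤ L) (hq : IntervalIntegrable q volume 0 L) {lam c : ℝ}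
    {y y' z z' : ℝ → ℝ} (hy : IsCaraSol q L lam y y') (hz : IsCaraSol q L lam z z')
    (h₀ : y 0 = c * z 0) (h₀' : y' 0 = c * z' 0) {x : ℝ} (hx : x ∈ Icc 0 L) :
    y x = c * z x ∧ y' x = c * z' x := by
  have h := (hy.sub_const_mul hq hz c).eq_zero hL hq (sub_eq_zero.2 h₀) (sub_eq_zero.2 h₀') hx
  exact ⟨sub_eq_zero.1 h.1, sub_eq_zero.1 h.2⟩

/-- The initial slope of a solution vanishing identically is zero. -/
theorem IsCaraSol.deriv_zero_eq_zero (hL : 0 < L) {lam : ℝ} {y y' : ℝ → ℝ}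
    (h : IsCaraSol q L lam y y') (hy : ∀ x ∈ Icc 0 L, y x = 0) : y' 0 = 0 := by
  have hconst : ∀ x ∈ Icc 0 L, y' x = y' 0 := by
    intro x hx
    rw [h.2.2.2 x hx, add_eq_left]
    refine intervalIntegral.integral_zero_ae (ae_of_all _ fun t ht => ?_)
    rw [uIoc_of_le hx.1] at ht
    rw [hy t ⟨ht.1.le, ht.2.trans hx.2⟩, mul_zero]
  have hint : ∫ t in (0:ℝ)..L, y' t = L * y' 0 := by
    rw [intervalIntegral.integral_congr (g := fun _ => y' 0)]
    · simp
    · intro t ht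
      rw [uIcc_of_le hL.le] at ht
      exact hconst t ht
  have h₁ := h.2.2.1 L (right_mem_Icc.2 hL.le)
  rw [hy L (right_mem_Icc.2 hL.le), hy 0 (left_mem_Icc.2 hL.le), hint] at h₁
  have h₂ : L * y' 0 = 0 := by linarith
  exact (mul_eq_zero.1 h₂).resolve_left hL.ne'

end InitialValueProblem

section Reflection

namespace IsCaraSol

variable {Q R : ℝ → ℝ} {L M lam : ℝ} {y y' z z' : ℝ → ℝ}

theorem mono (h : IsCaraSol Q L lam y y') (hML : M ≤ L) : IsCaraSol Q M lam y y' :=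
  ⟨h.1.mono (Icc_subset_Icc_right hML), h.2.1.mono (Icc_subset_Icc_right hML),
    fun x hx => h.2.2.1 x ⟨hx.1, hx.2.trans hML⟩, fun x hx => h.2.2.2 x ⟨hx.1, hx.2.trans hML⟩⟩

theorem congr_potential (h : IsCaraSol Q L lam y y') (hQR : ∀ t ∈ Icc 0 L, Q t = R t) :
    IsCaraSol R L lam y y' := by
  refine ⟨h.1, h.2.1, h.2.2.1, fun x hx => ?_⟩
  rw [h.2.2.2 x hx]
  congr 1
  refine intervalIntegral.integral_congr fun t ht => ?_
  rw [uIcc_of_le hx.1] at ht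
  simp only [hQR t ⟨ht.1, ht.2.trans hx.2⟩]

theorem const_mul (h : IsCaraSol Q L lam y y') (c : ℝ) :
    IsCaraSol Q L lam (fun x => c * y x) (fun x => c * y' x) := by
  refine ⟨h.1.const_mul c, h.2.1.const_mul c, fun x hx => ?_, fun x hx => ?_⟩
  · rw [intervalIntegral.integral_const_mul]
    linear_combination c * h.2.2.1 x hx
  · simp_rw [mul_left_comm _ c]
    rw [intervalIntegral.integral_const_mul]
    linear_combination c * h.2.2.2 x hx

theorem comp_sub_left (hQ : IntervalIntegrable Q volume 0 L) (h : IsCaraSol Q L lam y y') :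
    IsCaraSol (fun t => Q (L - t)) L lam (fun x => y (L - x)) (fun x => -y' (L - x)) := by
  have hmaps : MapsTo (fun x => L - x) (Icc 0 L) (Icc 0 L) := fun x hx =>
    ⟨sub_nonneg.2 hx.2, sub_le_self _ hx.1⟩
  have hcont : ContinuousOn (fun x => L - x) (Icc 0 L) := by fun_prop
  have hprim : ∀ {u v : ℝ → ℝ}, IntervalIntegrable v volume 0 L →
      (∀ x ∈ Icc 0 L, u x = u 0 + ∫ t in (0:ℝ)..x, v t) →
      ∀ x ∈ Icc 0 L, u (L - x) = u L - ∫ t in (0:ℝ)..x, v (L - t) := by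
    intro u v hv hu x hx
    have hL : 0 ≤ L := hx.1.trans hx.2
    rw [intervalIntegral.integral_comp_sub_left (fun t => v t), sub_zero, hu _ (hmaps hx),
      hu L (right_mem_Icc.2 hL), ← intervalIntegral.integral_add_adjacent_intervals
        (a := 0) (b := L - x) (c := L)]
    · ring
    · refine hv.mono_set ?_
      rw [uIcc_of_le (hmaps hx).1, uIcc_of_le hL]
      exact Icc_subset_Icc_right (hmaps hx).2
    · refine hv.mono_set ?_
      rw [uIcc_of_le (hmaps hx).2, uIcc_of_le hL]
      exact Icc_subset_Icc_left (hmaps hx).1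
  refine ⟨h.1.comp hcont hmaps, (h.2.1.comp hcont hmaps).neg, fun x hx => ?_, fun x hx => ?_⟩
  all_goals have hL : 0 ≤ L := hx.1.trans hx.2
  · simp only [sub_zero, intervalIntegral.integral_neg]
    rw [hprim (h.continuousOn_uIcc_deriv hL).intervalIntegrable h.2.2.1 x hx, sub_eq_add_neg]
  · simp only [sub_zero]
    rw [hprim (h.intervalIntegrable_mul hL hQ) h.2.2.2 x hx]
    ring

/-- Gluing a solution on `[0, L]` to a solution on `[L, L + M]` with matching Cauchy data. -/
theorem glue (hL : 0 ≤ L) (hM : 0 ≤ M) (hQ : IntervalIntegrable Q volume 0 (L + M))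
    (hy : IsCaraSol Q L lam y y') (hz : IsCaraSol (fun t => Q (L + t)) M lam z z')
    (h₀ : y L = z 0) (h₀' : y' L = z' 0) :
    ∃ w w' : ℝ → ℝ, IsCaraSol Q (L + M) lam w w' ∧
      (∀ x ∈ Icc 0 L, w x = y x ∧ w' x = y' x) ∧
      (∀ x ∈ Icc 0 M, w (L + x) = z x ∧ w' (L + x) = z' x) := by
  let g : (ℝ → ℝ) → (ℝ → ℝ) → ℝ → ℝ := fun u v x => u (min x L) + v (max x L - L) - v 0
  have hg₁ : ∀ {u v : ℝ → ℝ}, ∀ x ∈ Icc 0 L, g u v x = u x := fun {u v} x hx => by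
    simp [g, min_eq_left hx.2, max_eq_right hx.2]
  have hg₂ : ∀ {u v : ℝ → ℝ}, u L = v 0 → ∀ x ∈ Icc 0 M, g u v (L + x) = v x := by
    intro u v huv x hx
    simp [g, hx.1, huv]
  have hgc : ∀ {u v : ℝ → ℝ}, ContinuousOn u (Icc 0 L) → ContinuousOn v (Icc 0 M) →
      ContinuousOn (g u v) (Icc 0 (L + M)) := by
    intro u v hu hv
    refine ((hu.comp (by fun_prop) ?_).add (hv.comp (by fun_prop) ?_)).sub continuousOn_const
    · exact fun x hx => ⟨le_min hx.1 hL, min_le_right _ _⟩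
    · refine fun x hx => ⟨by simp, ?_⟩
      simp only [tsub_le_iff_right, sup_le_iff]
      constructor <;> linarith [hx.2]
  have hprim : ∀ {u v ru rv k : ℝ → ℝ}, IntervalIntegrable k volume 0 (L + M) →
      (∀ t ∈ Icc 0 L, k t = ru t) → (∀ t ∈ Icc 0 M, k (L + t) = rv t) → u L = v 0 →
      (∀ x ∈ Icc 0 L, u x = u 0 + ∫ t in (0:ℝ)..x, ru t) →
      (∀ x ∈ Icc 0 M, v x = v 0 + ∫ t in (0:ℝ)..x, rv t) →
      ∀ x ∈ Icc 0 (L + M), g u v x = g u v 0 + ∫ t in (0:ℝ)..x, k t := by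
    intro u v ru rv k hk hru hrv huv hu hv x hx
    have h₁ : ∀ x ∈ Icc 0 L, ∫ t in (0:ℝ)..x, k t = ∫ t in (0:ℝ)..x, ru t := by
      intro x hx
      refine intervalIntegral.integral_congr fun t ht => ?_
      rw [uIcc_of_le hx.1] at ht
      exact hru t ⟨ht.1, ht.2.trans hx.2⟩
    rw [hg₁ 0 (left_mem_Icc.2 hL)]
    rcases le_total x L with hxL | hxL
    · rw [hg₁ x ⟨hx.1, hxL⟩, h₁ x ⟨hx.1, hxL⟩, hu x ⟨hx.1, hxL⟩]
    · have hxM : x - L ∈ Icc 0 M := ⟨sub_nonneg.2 hxL, by linarith [hx.2]⟩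
      have h₂ : ∫ t in L..x, k t = ∫ t in (0:ℝ)..(x - L), rv t := by
        have h₃ := intervalIntegral.integral_comp_add_left (a := 0) (b := x - L) (fun t => k t) L
        rw [add_zero, add_sub_cancel] at h₃
        rw [← h₃]
        refine intervalIntegral.integral_congr fun t ht => ?_
        rw [uIcc_of_le hxM.1] at ht
        exact hrv t ⟨ht.1, ht.2.trans hxM.2⟩
      rw [← intervalIntegral.integral_add_adjacent_intervals (b := L), h₁ L (right_mem_Icc.2 hL),
        h₂, ← add_assoc, ← hu L (right_mem_Icc.2 hL), huv, ← hv _ hxM]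
      · conv_lhs => rw [← add_sub_cancel L x]
        exact hg₂ huv _ hxM
      · refine hk.mono_set ?_
        rw [uIcc_of_le hL, uIcc_of_le (add_nonneg hL hM)]
        exact Icc_subset_Icc_right (by linarith)
      · refine hk.mono_set ?_
        rw [uIcc_of_le hxL, uIcc_of_le (add_nonneg hL hM)]
        exact Icc_subset_Icc hL hx.2
  have hwc := hgc hy.1 hz.1
  have hwc' := hgc hy.2.1 hz.2.1
  rw [← uIcc_of_le (add_nonneg hL hM)] at hwc hwc'
  refine ⟨g y z, g y' z', ⟨hgc hy.1 hz.1, hgc hy.2.1 hz.2.1, ?_, ?_⟩,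
    fun x hx => ⟨hg₁ x hx, hg₁ x hx⟩, fun x hx => ⟨hg₂ h₀ x hx, hg₂ h₀' x hx⟩⟩
  · exact hprim hwc'.intervalIntegrable hg₁ (hg₂ h₀') h₀ hy.2.2.1 hz.2.2.1
  · refine hprim ((hQ.sub intervalIntegrable_const).mul_continuousOn hwc) (fun t ht => ?_)
      (fun t ht => ?_) h₀' hy.2.2.2 hz.2.2.2
    · rw [hg₁ t ht]
    · rw [hg₂ h₀ t ht]

end IsCaraSol

variable {q : ℝ → ℝ}

theorem qSym_of_mem_Icc {t : ℝ} (ht : t ∈ Icc 0 Real.pi) : qSym q t = q t :=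
  if_pos ht.2

theorem qSym_two_pi_sub (t : ℝ) : qSym q (2 * Real.pi - t) = qSym q t := by
  unfold qSym
  rcases lt_trichotomy t Real.pi with h | rfl | h
  · rw [if_neg (by linarith), if_pos h.le, sub_sub_cancel]
  · simp [two_mul]
  · rw [if_pos (by linarith), if_neg (by linarith)]

theorem intervalIntegrable_qSym (hq : IntervalIntegrable q volume 0 Real.pi) :
    IntervalIntegrable (qSym q) volume 0 (2 * Real.pi) := by
  have h₁ : IntervalIntegrable (qSym q) volume 0 Real.pi :=
    hq.congr fun t ht => by
      rw [uIoc_of_le Real.pi_pos.le] at ht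
      exact (qSym_of_mem_Icc ⟨ht.1.le, ht.2⟩).symm
  have h₂ := (h₁.comp_sub_left (2 * Real.pi)).symm
  simp only [qSym_two_pi_sub] at h₂
  rw [sub_zero, two_mul, add_sub_cancel_right] at h₂
  rw [two_mul]
  exact h₁.trans h₂

theorem isEigenSym_iff (hq : IntervalIntegrable q volume 0 Real.pi) (f : RatHN) (lam : ℝ) :
    IsEigenSym q f lam ↔ IsEigen q f none lam ∨ IsEigen q f (some 0) lam := by
  have hpi := Real.pi_pos
  have hqS := intervalIntegrable_qSym hq
  constructor
  · rintro ⟨y, y', hsol, ⟨x₀, hx₀, hne⟩, hnp, hp⟩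
    have hrefl : IsCaraSol q Real.pi lam (fun x => y (2 * Real.pi - x))
        (fun x => -y' (2 * Real.pi - x)) := by
      refine ((hsol.comp_sub_left hqS).mono (by linarith)).congr_potential fun t ht => ?_
      rw [qSym_two_pi_sub, qSym_of_mem_Icc ht]
    have hsol' : IsCaraSol q Real.pi lam y y' :=
      (hsol.mono (by linarith)).congr_potential fun t ht => qSym_of_mem_Icc ht
    have hodd := hsol'.sub_const_mul hq hrefl 1
    have heven := hsol'.sub_const_mul hq hrefl (-1)
    have hnz : (∃ x ∈ Icc (0:ℝ) Real.pi, y x - 1 * y (2 * Real.pi - x) ≠ 0) ∨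
        ∃ x ∈ Icc (0:ℝ) Real.pi, y x - -1 * y (2 * Real.pi - x) ≠ 0 := by
      by_contra! hcon
      apply hne
      rcases le_total x₀ Real.pi with h | h
      · linarith [hcon.1 x₀ ⟨hx₀.1, h⟩, hcon.2 x₀ ⟨hx₀.1, h⟩]
      · have hmem : 2 * Real.pi - x₀ ∈ Icc 0 Real.pi := ⟨by linarith [hx₀.2], by linarith⟩
        have h₁ := hcon.1 _ hmem
        have h₂ := hcon.2 _ hmem
        rw [sub_sub_cancel] at h₁ h₂
        linarith
    have hmid : 2 * Real.pi - Real.pi = Real.pi := by ring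
    refine hnz.imp (fun hnz => ⟨_, _, hodd, hnz, fun h => ?_, fun h => ?_, fun _ h => ?_,
      fun _ => ?_⟩) (fun hnz => ⟨_, _, heven, hnz, fun h => ?_, fun h => ?_, fun b h => ?_,
      fun h => ?_⟩)
    · simp only [sub_zero]
      linear_combination (hnp h).1 + (hnp h).2
    · simp only [sub_zero]
      linear_combination (hp h).1 - (hp h).2
    · exact absurd h (by simp)
    · simp only [hmid]
      ring
    · simp only [sub_zero]
      linear_combination (hnp h).1 - (hnp h).2
    · simp only [sub_zero]
      linear_combination (hp h).1 + (hp h).2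
    · obtain rfl : 0 = b := by simpa using h
      simp only [hmid]
      ring
    · exact absurd h (by simp)
  · have hext : ∀ {s : ℝ} {u u' : ℝ → ℝ}, IsCaraSol q Real.pi lam u u' →
        (∃ x ∈ Icc (0:ℝ) Real.pi, u x ≠ 0) → (¬ f.IsPole lam → u' 0 = -f.eval lam * u 0) →
        (f.IsPole lam → u 0 = 0) → u Real.pi = s * u Real.pi →
        u' Real.pi = s * -u' Real.pi → IsEigenSym q f lam := by
      rintro s u u' hsol ⟨x₀, hx₀, hne⟩ hnp hp hs hs'
      have hrefl : IsCaraSol (fun t => qSym q (Real.pi + t)) Real.pi lam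
          (fun x => s * u (Real.pi - x)) (fun x => s * -u' (Real.pi - x)) := by
        refine ((hsol.comp_sub_left hq).const_mul s).congr_potential fun t ht => ?_
        rw [← qSym_two_pi_sub, two_mul, add_sub_add_left_eq_sub]
        exact (qSym_of_mem_Icc ⟨sub_nonneg.2 ht.2, sub_le_self _ ht.1⟩).symm
      rw [two_mul] at hqS
      obtain ⟨w, w', hw, hw₁, hw₂⟩ := IsCaraSol.glue hpi.le hpi.le hqS
        (hsol.congr_potential fun t ht => (qSym_of_mem_Icc ht).symm) hrefl
        (by simpa using hs) (by simpa using hs')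
      rw [← two_mul] at hw
      have h0 := hw₁ 0 (left_mem_Icc.2 hpi.le)
      have h2 := hw₂ Real.pi (right_mem_Icc.2 hpi.le)
      rw [← two_mul, sub_self] at h2
      refine ⟨w, w', hw, ⟨x₀, ⟨hx₀.1, by linarith [hx₀.2]⟩, by rwa [(hw₁ x₀ hx₀).1]⟩,
        fun h => ⟨?_, ?_⟩, fun h => ⟨?_, ?_⟩⟩
      · rw [h0.1, h0.2, hnp h]
      · rw [h2.1, h2.2, hnp h]
        ring
      · rw [h0.1, hp h]
      · rw [h2.1, hp h, mul_zero]
    rintro (⟨u, u', hsol, hne, hnp, hp, -, hb⟩ | ⟨u, u', hsol, hne, hnp, hp, hb, -⟩)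
    · exact hext (s := -1) hsol hne hnp hp (by simp [hb rfl]) (by ring)
    · exact hext (s := 1) hsol hne hnp hp (by ring) (by simp [hb 0 rfl])

end Reflection

namespace RatHN

/-- The polynomial `∏ (β_j - λ)`, whose zeros are the poles of `f`. -/
def den (f : RatHN) (lam : ℝ) : ℝ := ∏ j, (f.β j - lam)

/-- The product of the factors of `f.den` other than the `j`-th one. -/
def cofactor (f : RatHN) (j : Fin f.n) (lam : ℝ) : ℝ := ∏ i ∈ Finset.univ.erase j, (f.β i - lam)

/-- The polynomial `f.eval * f.den`. -/
def num (f : RatHN) (lam : ℝ) : ℝ :=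
  (f.a * lam + f.c) * f.den lam + ∑ j, f.γ j * f.cofactor j lam

variable (f : RatHN)

theorem continuous_den : Continuous f.den := by
  unfold den
  fun_prop

theorem continuous_cofactor (j : Fin f.n) : Continuous (f.cofactor j) := by
  unfold cofactor
  fun_prop

theorem continuous_num : Continuous f.num := by
  have h₁ := f.continuous_den
  have h₂ := f.continuous_cofactor
  unfold num
  fun_prop

theorem den_eq_mul_cofactor (j : Fin f.n) (lam : ℝ) :
    f.den lam = (f.β j - lam) * f.cofactor j lam :=
  (Finset.mul_prod_erase _ _ (Finset.mem_univ j)).symm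

theorem den_eq_zero_iff {lam : ℝ} : f.den lam = 0 ↔ f.IsPole lam := by
  simp [den, IsPole, Finset.prod_eq_zero_iff, sub_eq_zero]

theorem num_eq_eval_mul_den {lam : ℝ} (h : ¬ f.IsPole lam) :
    f.num lam = f.eval lam * f.den lam := by
  rw [num, eval, add_mul _ (∑ j, f.γ j / (f.β j - lam)), Finset.sum_mul]
  congr 1
  refine Finset.sum_congr rfl fun j _ => ?_
  have hj : f.β j - lam ≠ 0 := fun hj => h ⟨j, sub_eq_zero.1 hj⟩
  rw [f.den_eq_mul_cofactor j]
  field_simp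

theorem num_ne_zero_of_isPole {lam : ℝ} (h : f.IsPole lam) : f.num lam ≠ 0 := by
  rw [num, f.den_eq_zero_iff.2 h, mul_zero, zero_add]
  obtain ⟨j, rfl⟩ := h
  rw [Finset.sum_eq_single j]
  · refine mul_ne_zero (f.hγ j).ne' (Finset.prod_ne_zero_iff.2 fun i hi => sub_ne_zero.2 ?_)
    exact f.hβ.injective.ne (Finset.ne_of_mem_erase hi)
  · intro i _ hij
    rw [cofactor, Finset.prod_eq_zero (Finset.mem_erase.2 ⟨hij.symm, Finset.mem_univ j⟩)
      (sub_self _), mul_zero]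
  · simp

theorem num_mul_den_sub (lam mu : ℝ) :
    f.num lam * f.den mu - f.num mu * f.den lam = (lam - mu) *
      (f.a * (f.den lam * f.den mu) + ∑ j, f.γ j * (f.cofactor j lam * f.cofactor j mu)) := by
  have h : (∑ j, f.γ j * f.cofactor j lam) * f.den mu -
      (∑ j, f.γ j * f.cofactor j mu) * f.den lam =
        (lam - mu) * ∑ j, f.γ j * (f.cofactor j lam * f.cofactor j mu) := by
    rw [Finset.sum_mul, Finset.sum_mul, Finset.mul_sum, ← Finset.sum_sub_distrib]
    refine Finset.sum_congr rfl fun j _ => ?_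
    rw [f.den_eq_mul_cofactor j lam, f.den_eq_mul_cofactor j mu]
    ring
  rw [num, num]
  linear_combination h

/-- `f` is bounded above and free of poles near `-∞`. -/
theorem exists_eval_le : ∃ m C : ℝ, 0 ≤ C ∧
    ∀ lam ≤ m, ¬ f.IsPole lam ∧ f.eval lam ≤ C := by
  have hβ : ∀ lam ≤ -(∑ j, |f.β j|) - 1, ∀ j, 1 ≤ f.β j - lam := by
    intro lam hlam j
    have := Finset.single_le_sum (f := fun j => |f.β j|) (fun _ _ => abs_nonneg _)
      (Finset.mem_univ j)
    linarith [neg_abs_le (f.β j)]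
  refine ⟨-(∑ j, |f.β j|) - 1, |f.c| + ∑ j, f.γ j,
    add_nonneg (abs_nonneg _) (Finset.sum_nonneg fun j _ => (f.hγ j).le), fun lam hlam => ⟨?_, ?_⟩⟩
  · rintro ⟨j, rfl⟩
    linarith [hβ _ hlam j]
  · have hlam0 : lam ≤ 0 := by
      linarith [Finset.sum_nonneg fun (j : Fin f.n) (_ : j ∈ Finset.univ) => abs_nonneg (f.β j)]
    have h₁ : f.a * lam ≤ 0 := mul_nonpos_of_nonneg_of_nonpos f.ha hlam0
    have h₂ : ∑ j, f.γ j / (f.β j - lam) ≤ ∑ j, f.γ j :=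
      Finset.sum_le_sum fun j _ => div_le_self (f.hγ j).le (hβ lam hlam j)
    rw [eval]
    linarith [le_abs_self f.c]

end RatHN

theorem isEigen_iff {q : ℝ → ℝ} (hq : IntervalIntegrable q volume 0 Real.pi) (f : RatHN)
    {lam : ℝ} {y y' : ℝ → ℝ} (hy : IsCaraSol q Real.pi lam y y') (h₀ : y 0 = f.den lam)
    (h₀' : y' 0 = -f.num lam) (b : Option ℝ) :
    IsEigen q f b lam ↔ (∀ bb : ℝ, b = some bb → y' Real.pi = bb * y Real.pi) ∧
      (b = none → y Real.pi = 0) := by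
  have hpi := Real.pi_pos
  have hπ : Real.pi ∈ Icc 0 Real.pi := right_mem_Icc.2 hpi.le
  constructor
  · rintro ⟨z, z', hz, ⟨x, hx, hne⟩, hnp, hp, hb, hb'⟩
    obtain ⟨c, hc, hc'⟩ : ∃ c, z 0 = c * y 0 ∧ z' 0 = c * y' 0 := by
      rw [h₀, h₀']
      by_cases h : f.IsPole lam
      · have hnum := f.num_ne_zero_of_isPole h
        refine ⟨-z' 0 / f.num lam, ?_, ?_⟩
        · rw [hp h, f.den_eq_zero_iff.2 h, mul_zero]
        · field_simp
      · have hden := mt f.den_eq_zero_iff.1 h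
        refine ⟨z 0 / f.den lam, ?_, ?_⟩
        · field_simp
        · rw [hnp h, f.num_eq_eval_mul_den h]
          field_simp
    have hzy := fun {x} (hx : x ∈ Icc 0 Real.pi) => hz.eq_const_mul hpi.le hq hy hc hc' hx
    have hc0 : c ≠ 0 := by
      rintro rfl
      exact hne (by rw [(hzy hx).1, zero_mul])
    refine ⟨fun bb h => ?_, fun h => ?_⟩
    · have h₁ := hb bb h
      rw [(hzy hπ).1, (hzy hπ).2, mul_left_comm] at h₁
      exact mul_left_cancel₀ hc0 h₁
    · have h₁ := hb' h
      rw [(hzy hπ).1] at h₁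
      exact (mul_eq_zero.1 h₁).resolve_left hc0
  · rintro ⟨hb, hb'⟩
    refine ⟨y, y', hy, ?_, fun h => ?_, fun h => ?_, hb, hb'⟩
    · by_contra! hcon
      have hnum := hy.deriv_zero_eq_zero hpi hcon
      rw [h₀', neg_eq_zero] at hnum
      refine f.num_ne_zero_of_isPole (f.den_eq_zero_iff.1 ?_) hnum
      rw [← h₀, hcon 0 (left_mem_Icc.2 hpi.le)]
    · rw [h₀, h₀', f.num_eq_eval_mul_den h]
      ring
    · rw [h₀, f.den_eq_zero_iff.2 h]

section Interlacing

open Filter Topology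

variable {D E : ℝ → ℝ} {K : ℝ → ℝ → ℝ}

theorem ne_zero_of_wronskian (hK : ∀ s t, D s * E t - E s * D t = (s - t) * K s t)
    (hKc : ∀ s, Continuous (K s)) (hKpos : ∀ s, 0 < K s s) {s : ℝ} (hD : D s = 0) : E s ≠ 0 := by
  intro hE
  have h : ∀ᶠ t in 𝓝[≠] s, 0 < K s t :=
    ((hKc s).continuousAt.eventually (lt_mem_nhds (hKpos s))).filter_mono nhdsWithin_le_nhds
  obtain ⟨t, ht, hts⟩ := (h.and self_mem_nhdsWithin).exists
  have h₁ := hK s t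
  rw [hD, hE, zero_mul, zero_mul, sub_zero, eq_comm, mul_eq_zero] at h₁
  exact h₁.elim (fun h => hts (sub_eq_zero.1 h).symm) ht.ne'

theorem strictAntiOn_div_of_wronskian (hDc : Continuous D)
    (hK : ∀ s t, D s * E t - E s * D t = (s - t) * K s t)
    (hKc : ∀ s, Continuous (K s)) (hKpos : ∀ s, 0 < K s s) {S : Set ℝ} (hS : Convex ℝ S)
    (hD : ∀ s ∈ S, D s ≠ 0) : StrictAntiOn (fun s => E s / D s) S := by
  have hderiv : ∀ s ∈ S, HasDerivAt (fun s => E s / D s) (-K s s / (D s * D s)) s := by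
    intro s hs
    rw [hasDerivAt_iff_tendsto_slope]
    have hlim : Tendsto (fun t => -K s t / (D s * D t)) (𝓝[≠] s) (𝓝 (-K s s / (D s * D s))) := by
      refine Tendsto.mono_left ?_ nhdsWithin_le_nhds
      exact ((hKc s).neg.tendsto s).div ((hDc.tendsto s).const_mul _)
        (mul_ne_zero (hD s hs) (hD s hs))
    refine hlim.congr' ?_
    have hne : ∀ᶠ t in 𝓝[≠] s, D t ≠ 0 :=
      (hDc.continuousAt.eventually_ne (hD s hs)).filter_mono nhdsWithin_le_nhds
    filter_upwards [hne, self_mem_nhdsWithin] with t ht hts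
    have hDs := hD s hs
    have hts' : t - s ≠ 0 := sub_ne_zero.2 hts
    rw [slope_def_field]
    field_simp
    linear_combination -hK s t
  refine strictAntiOn_of_hasDerivWithinAt_neg hS
    (fun s hs => (hderiv s hs).continuousAt.continuousWithinAt)
    (fun s hs => (hderiv s (interior_subset hs)).hasDerivWithinAt) fun s hs => ?_
  have hDs := hD s (interior_subset hs)
  exact div_neg_of_neg_of_pos (neg_neg_of_pos (hKpos s)) (mul_self_pos.2 hDs)

theorem exists_zero_between_of_wronskian (hDc : Continuous D)
    (hK : ∀ s t, D s * E t - E s * D t = (s - t) * K s t)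
    (hKc : ∀ s, Continuous (K s)) (hKpos : ∀ s, 0 < K s s) {s t : ℝ} (hst : s < t)
    (hs : E s = 0) (ht : E t = 0) : ∃ r ∈ Ioo s t, D r = 0 := by
  by_contra! hcon
  have hne : ∀ {r}, E r = 0 → D r ≠ 0 := fun {r} h h' =>
    ne_zero_of_wronskian hK hKc hKpos h' h
  have hD : ∀ r ∈ Icc s t, D r ≠ 0 := by
    intro r hr
    rcases eq_or_lt_of_le hr.1 with rfl | h₁
    · exact hne hs
    rcases eq_or_lt_of_le hr.2 with rfl | h₂
    · exact hne ht
    exact hcon r ⟨h₁, h₂⟩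
  have h := strictAntiOn_div_of_wronskian hDc hK hKc hKpos (convex_Icc s t) hD
    (left_mem_Icc.2 hst.le) (right_mem_Icc.2 hst.le) hst
  simp [hs, ht] at h

theorem exists_zero_lt_of_wronskian (hDc : Continuous D)
    (hK : ∀ s t, D s * E t - E s * D t = (s - t) * K s t)
    (hKc : ∀ s, Continuous (K s)) (hKpos : ∀ s, 0 < K s s) {m : ℝ}
    (hm : ∀ s ≤ m, D s * E s ≤ 0) {t : ℝ} (ht : E t = 0) : ∃ r < t, D r = 0 := by
  by_contra! hcon
  have hD : ∀ r ∈ Iic t, D r ≠ 0 := by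
    intro r hr
    rcases eq_or_lt_of_le (mem_Iic.1 hr) with rfl | h
    · exact fun h' => ne_zero_of_wronskian hK hKc hKpos h' ht
    · exact hcon r h
  have hlt : min m (t - 1) < t := (min_le_right _ _).trans_lt (sub_one_lt t)
  have h := strictAntiOn_div_of_wronskian hDc hK hKc hKpos (convex_Iic t) hD
    hlt.le self_mem_Iic hlt
  simp only [ht, zero_div] at h
  have hm' := hm _ (min_le_left m (t - 1))
  rcases div_pos_iff.1 h with ⟨h₁, h₂⟩ | ⟨h₁, h₂⟩
  · exact hm'.not_gt (mul_pos h₂ h₁)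
  · exact hm'.not_gt (mul_pos_of_neg_of_neg h₂ h₁)

end Interlacing

/-- Two interlacing sequences are the even and odd parts of the enumeration of their union. -/
theorem IsEnum.eq_of_interlacing {A B : Set ℝ} {a b c : ℕ → ℝ} (ha : IsEnum A a) (hb : IsEnum B b)
    (hc : IsEnum (B ∪ A) c) (hlt : ∀ y ∈ B, ∃ x ∈ A, x < y)
    (hA : ∀ x ∈ A, ∀ x' ∈ A, x < x' → ∃ y ∈ B, y ∈ Ioo x x')
    (hB : ∀ y ∈ B, ∀ y' ∈ B, y < y' → ∃ x ∈ A, x ∈ Ioo y y') (k : ℕ) :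
    c (2 * k + 1) = b k ∧ c (2 * k) = a k := by
  obtain ⟨ha, rfl⟩ := ha
  obtain ⟨hb, rfl⟩ := hb
  obtain ⟨hc, hcr⟩ := hc
  simp only [forall_mem_range, exists_range_iff] at hlt hA hB
  have hstep : ∀ k, a k < b k ∧ b k < a (k + 1) := by
    intro k
    induction k with
    | zero =>
      obtain ⟨i, hi⟩ := hlt 0
      have h₁ : a 0 < b 0 := (ha.monotone (Nat.zero_le i)).trans_lt hi
      obtain ⟨j, hj⟩ := hA 0 1 (ha one_pos)
      exact ⟨h₁, (hb.monotone (Nat.zero_le j)).trans_lt hj.2⟩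
    | succ k ih =>
      obtain ⟨i, hi⟩ := hB k (k + 1) (hb k.lt_succ_self)
      have hki : k + 1 ≤ i := ha.lt_iff_lt.1 (ih.1.trans hi.1)
      obtain ⟨j, hj⟩ := hA (k + 1) (k + 2) (ha (k + 1).lt_succ_self)
      have hkj : k + 1 ≤ j := hb.lt_iff_lt.1 (ih.2.trans hj.1)
      exact ⟨(ha.monotone hki).trans_lt hi.2, (hb.monotone hkj).trans_lt hj.2⟩
  let e : ℕ → ℝ := fun n => if Even n then a (n / 2) else b (n / 2)
  have he₀ : ∀ k, e (2 * k) = a k := fun k => by simp [e]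
  have he₁ : ∀ k, e (2 * k + 1) = b k := fun k => by
    have h : (2 * k + 1) / 2 = k := by omega
    simp [e, h]
  have he : StrictMono e := by
    refine strictMono_nat_of_lt_succ fun n => ?_
    obtain ⟨k, rfl | rfl⟩ := n.even_or_odd'
    · rw [he₀, he₁]
      exact (hstep k).1
    · rw [he₁, show 2 * k + 1 + 1 = 2 * (k + 1) by ring, he₀]
      exact (hstep k).2
  have her : range e = range b ∪ range a := by
    ext x
    simp only [mem_union, mem_range]
    constructor
    · rintro ⟨n, rfl⟩
      obtain ⟨k, rfl | rfl⟩ := n.even_or_odd'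
      · exact Or.inr ⟨k, (he₀ k).symm⟩
      · exact Or.inl ⟨k, (he₁ k).symm⟩
    · rintro (⟨k, rfl⟩ | ⟨k, rfl⟩)
      · exact ⟨_, he₁ k⟩
      · exact ⟨_, he₀ k⟩
  rw [(hc.range_inj he).1 (hcr.trans her.symm)]
  exact ⟨he₁ k, he₀ k⟩

section Energy

variable {L : ℝ}

theorem sq_le_of_primitive {F f : ℝ → ℝ} (hL : 0 < L) (hFc : ContinuousOn F (Icc 0 L))
    (hfc : ContinuousOn f (Icc 0 L)) (hF : ∀ x ∈ Icc 0 L, F x = F 0 + ∫ t in (0:ℝ)..x, f t)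
    {N : ℝ} (hN : 0 < N) {x : ℝ} (hx : x ∈ Icc 0 L) :
    F x ^ 2 ≤ 1 / N * (∫ t in (0:ℝ)..L, f t ^ 2) + (N + 1 / L) * ∫ t in (0:ℝ)..L, F t ^ 2 := by
  rw [← uIcc_of_le hL.le] at hFc hfc
  have hFi : IntervalIntegrable (fun t => F t ^ 2) volume 0 L := (hFc.pow 2).intervalIntegrable
  have hfi : IntervalIntegrable (fun t => f t ^ 2) volume 0 L := (hfc.pow 2).intervalIntegrable
  have hgi : IntervalIntegrable (fun t => 1 / N * f t ^ 2 + N * F t ^ 2) volume 0 L :=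
    (hfi.const_mul _).add (hFi.const_mul _)
  have hFf : IntervalIntegrable (fun t => f t * F t + F t * f t) volume 0 L :=
    ((hfc.mul hFc).add (hFc.mul hfc)).intervalIntegrable
  obtain ⟨m, hm, hmin⟩ := isCompact_uIcc.exists_isMinOn nonempty_uIcc (hFc.pow 2)
  rw [uIcc_of_le hL.le] at hm
  have h₁ : L * F m ^ 2 ≤ ∫ t in (0:ℝ)..L, F t ^ 2 := by
    have h := intervalIntegral.integral_mono_on hL.le intervalIntegrable_const hFi
      (f := fun _ => F m ^ 2) fun t ht => hmin (by rwa [uIcc_of_le hL.le])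
    simpa using h
  have h₂ : F x ^ 2 - F m ^ 2 = ∫ t in m..x, (f t * F t + F t * f t) := by
    have hfi' := hfc.intervalIntegrable (μ := volume)
    have hsub : ∀ {z}, z ∈ Icc 0 L → uIcc 0 z ⊆ uIcc 0 L := fun {z} hz =>
      uIcc_subset_uIcc left_mem_uIcc (by rwa [uIcc_of_le hL.le])
    rw [← intervalIntegral.integral_interval_sub_left (hFf.mono_set (hsub hx))
      (hFf.mono_set (hsub hm))]
    linear_combination mul_eq_add_integral_of_primitives hfi' hfi' hF hF hx -
      mul_eq_add_integral_of_primitives hfi' hfi' hF hF hm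
  have hmx : uIoc m x ⊆ uIoc 0 L := by
    rw [uIoc, uIoc_of_le hL.le]
    exact Ioc_subset_Ioc (le_min hm.1 hx.1) (max_le hm.2 hx.2)
  have h₃ : ‖∫ t in m..x, (f t * F t + F t * f t)‖ ≤
      |∫ t in m..x, (1 / N * f t ^ 2 + N * F t ^ 2)| := by
    refine intervalIntegral.norm_integral_le_abs_of_norm_le (ae_of_all _ fun t => ?_)
      (hgi.mono_set' hmx)
    have h : 1 / N * f t ^ 2 + N * F t ^ 2 - 2 * (|f t| * |F t|) =
        1 / N * (|f t| - N * |F t|) ^ 2 := by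
      rw [← sq_abs (f t), ← sq_abs (F t)]
      field_simp
      ring
    have h' : 0 ≤ 1 / N * (|f t| - N * |F t|) ^ 2 := by positivity
    rw [mul_comm (F t), ← two_mul, Real.norm_eq_abs, abs_mul, abs_mul, Nat.abs_ofNat]
    linarith
  have h₄ : |∫ t in m..x, (1 / N * f t ^ 2 + N * F t ^ 2)| ≤
      |∫ t in (0:ℝ)..L, (1 / N * f t ^ 2 + N * F t ^ 2)| :=
    intervalIntegral.abs_integral_mono_interval hmx (ae_of_all _ fun t => by positivity) hgi
  rw [abs_of_nonneg (intervalIntegral.integral_nonneg hL.le fun t _ => by positivity),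
    intervalIntegral.integral_add (hfi.const_mul _) (hFi.const_mul _),
    intervalIntegral.integral_const_mul, intervalIntegral.integral_const_mul] at h₄
  have h₅ : F m ^ 2 ≤ 1 / L * ∫ t in (0:ℝ)..L, F t ^ 2 := by
    rw [one_div, inv_mul_eq_div, le_div_iff₀ hL]
    linarith
  linarith [le_abs_self (∫ t in m..x, (f t * F t + F t * f t)),
    Real.norm_eq_abs (∫ t in m..x, (f t * F t + F t * f t))]

/-- For spectral parameters near `-∞`, solutions whose logarithmic derivative is bounded below at
the left endpoint have nonnegative logarithmic derivative at the right endpoint. -/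
theorem exists_forall_le_mul_deriv_nonneg {q : ℝ → ℝ} (hL : 0 < L)
    (hq : IntervalIntegrable q volume 0 L) {C : ℝ} (hC : 0 ≤ C) :
    ∃ m : ℝ, ∀ lam ≤ m, ∀ y y' : ℝ → ℝ, IsCaraSol q L lam y y' →
      -(C * y 0 ^ 2) ≤ y 0 * y' 0 → 0 ≤ y L * y' L := by
  set Q : ℝ := ∫ t in (0:ℝ)..L, |q t| with hQ
  have hQ0 : 0 ≤ Q := intervalIntegral.integral_nonneg hL.le fun t _ => abs_nonneg _
  set N : ℝ := Q + C + 1 with hN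
  have hN0 : 0 < N := by positivity
  refine ⟨-(N * (N + 1 / L)), fun lam hlam y y' hy h0 => ?_⟩
  have hyc := hy.continuousOn_uIcc hL.le
  have hyc' := hy.continuousOn_uIcc_deriv hL.le
  set I₀ : ℝ := ∫ t in (0:ℝ)..L, y t ^ 2 with hI₀
  set I₁ : ℝ := ∫ t in (0:ℝ)..L, y' t ^ 2 with hI₁
  have hI₀0 : 0 ≤ I₀ := intervalIntegral.integral_nonneg hL.le fun t _ => sq_nonneg _
  set S : ℝ := 1 / N * I₁ + (N + 1 / L) * I₀ with hS
  have hyS : ∀ x ∈ Icc 0 L, y x ^ 2 ≤ S := fun x hx =>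
    sq_le_of_primitive hL hy.1 hy.2.1 hy.2.2.1 hN0 hx
  have hqy : IntervalIntegrable (fun t => q t * y t ^ 2) volume 0 L :=
    hq.mul_continuousOn (hyc.pow 2)
  have hyi : IntervalIntegrable (fun t => y t ^ 2) volume 0 L := (hyc.pow 2).intervalIntegrable
  have hyi' : IntervalIntegrable (fun t => y' t ^ 2) volume 0 L := (hyc'.pow 2).intervalIntegrable
  have hqS : -(Q * S) ≤ ∫ t in (0:ℝ)..L, q t * y t ^ 2 := by
    rw [hQ, ← intervalIntegral.integral_mul_const, ← intervalIntegral.integral_neg]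
    refine intervalIntegral.integral_mono_on hL.le (hq.abs.mul_const S).neg hqy fun t ht => ?_
    have h₁ := mul_le_mul_of_nonneg_left (hyS t ht) (abs_nonneg (q t))
    have h₂ := mul_le_mul_of_nonneg_right (neg_abs_le (q t)) (sq_nonneg (y t))
    linarith
  have hE : y L * y' L = y 0 * y' 0 + (I₁ + (∫ t in (0:ℝ)..L, q t * y t ^ 2) - lam * I₀) := by
    rw [mul_eq_add_integral_of_primitives hyc'.intervalIntegrable
      (hy.intervalIntegrable_mul hL.le hq) hy.2.2.1 hy.2.2.2 (right_mem_Icc.2 hL.le), hI₀, hI₁,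
      ← intervalIntegral.integral_const_mul, ← intervalIntegral.integral_add
        hyi' hqy, ← intervalIntegral.integral_sub
        (hyi'.add hqy) (hyi.const_mul lam)]
    congr 1
    exact intervalIntegral.integral_congr fun t _ => by ring
  have hCS := mul_le_mul_of_nonneg_left (hyS 0 (left_mem_Icc.2 hL.le)) hC
  have hlamI := mul_le_mul_of_nonneg_right hlam hI₀0
  have hNS : N * S = I₁ + N * (N + 1 / L) * I₀ := by
    rw [hS]
    field_simp
  have hS0 : 0 ≤ S := (sq_nonneg _).trans (hyS 0 (left_mem_Icc.2 hL.le))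
  have hNS' : N * S = Q * S + C * S + S := by rw [hN]; ring
  linarith

end Energy

theorem symmetric_eigenvalue_interlacing
    (q : ℝ → ℝ) (hq : IntegrableOn q (Ioo 0 Real.pi))
    (f : RatHN)
    (Λsym Λinf Λzero : ℕ → ℝ)
    (hΛsym : IsEnum {lam : ℝ | IsEigenSym q f lam} Λsym)
    (hΛinf : IsEnum (eigenvalues q f none) Λinf)
    (hΛzero : IsEnum (eigenvalues q f (some 0)) Λzero) :
    ∀ k : ℕ, Λsym (2 * k + 1) = Λinf k ∧ Λsym (2 * k) = Λzero k := by
  have hpi := Real.pi_pos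
  have hπ : Real.pi ∈ Icc 0 Real.pi := right_mem_Icc.2 hpi.le
  have hq' : IntervalIntegrable q volume 0 Real.pi :=
    (intervalIntegrable_iff_integrableOn_Ioo_of_le hpi.le).2 hq
  obtain ⟨Y, Y', hYc, hYc', hY⟩ :=
    exists_isCaraSol_family hpi.le hq' f.continuous_den f.continuous_num.neg
  set D : ℝ → ℝ := fun s => IccExtend hpi.le (Y s) Real.pi with hD
  set E : ℝ → ℝ := fun s => IccExtend hpi.le (Y' s) Real.pi with hE
  have hDc : Continuous D := by
    simp only [hD, IccExtend_of_mem hpi.le _ hπ]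
    fun_prop
  have hEc : Continuous E := by
    simp only [hE, IccExtend_of_mem hpi.le _ hπ]
    fun_prop
  set K : ℝ → ℝ → ℝ := fun s t => f.a * (f.den s * f.den t) +
    ∑ j, f.γ j * (f.cofactor j s * f.cofactor j t) +
      ∫ x in (0:ℝ)..Real.pi, IccExtend hpi.le (Y s) x * IccExtend hpi.le (Y t) x with hKdef
  have hK : ∀ s t, D s * E t - E s * D t = (s - t) * K s t := by
    intro s t
    have h := (hY s).1.wronskian_eq hpi.le hq' (hY t).1
    rw [(hY s).2.1, (hY s).2.2, (hY t).2.1, (hY t).2.2] at h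
    simp only [Pi.neg_apply] at h
    rw [hKdef]
    linear_combination h + f.num_mul_den_sub s t
  have hKc : ∀ s, Continuous (K s) := by
    intro s
    have h : ∀ t, ∫ x in (0:ℝ)..Real.pi, IccExtend hpi.le (Y s) x * IccExtend hpi.le (Y t) x =
        volterra hpi.le (fun _ => 1) intervalIntegrable_const (Y s * Y t) ⟨Real.pi, hπ⟩ := by
      intro t
      rw [volterra_apply]
      exact intervalIntegral.integral_congr fun x _ => by simp [IccExtend]
    have h₁ := f.continuous_den
    have h₂ := f.continuous_cofactor
    simp only [hKdef, h]
    fun_prop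
  have hKpos : ∀ s, 0 < K s s := by
    intro s
    have hcont := continuous_IccExtend_coe hpi.le (Y s)
    have h₁ : 0 < ∫ x in (0:ℝ)..Real.pi, IccExtend hpi.le (Y s) x * IccExtend hpi.le (Y s) x := by
      have hne : ∃ x ∈ Icc 0 Real.pi, IccExtend hpi.le (Y s) x ≠ 0 := by
        by_contra! hcon
        have hnum := (hY s).1.deriv_zero_eq_zero hpi hcon
        rw [(hY s).2.2, Pi.neg_apply, neg_eq_zero] at hnum
        refine f.num_ne_zero_of_isPole (f.den_eq_zero_iff.1 ?_) hnum
        rw [← (hY s).2.1, hcon 0 (left_mem_Icc.2 hpi.le)]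
      obtain ⟨x, hx, hne⟩ := hne
      exact intervalIntegral.integral_pos hpi (hcont.mul hcont).continuousOn
        (fun x _ => mul_self_nonneg _) ⟨x, hx, mul_self_pos.2 hne⟩
    have h₂ : 0 ≤ f.a * (f.den s * f.den s) := mul_nonneg f.ha (mul_self_nonneg _)
    have h₃ : 0 ≤ ∑ j, f.γ j * (f.cofactor j s * f.cofactor j s) :=
      Finset.sum_nonneg fun j _ => mul_nonneg (f.hγ j).le (mul_self_nonneg _)
    rw [hKdef]
    linarith
  have hinf : ∀ s, s ∈ eigenvalues q f none ↔ D s = 0 := fun s => by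
    rw [eigenvalues, mem_ofPred_eq, isEigen_iff hq' f (hY s).1 (hY s).2.1 (hY s).2.2]
    simp [hD]
  have hzero : ∀ s, s ∈ eigenvalues q f (some 0) ↔ E s = 0 := fun s => by
    rw [eigenvalues, mem_ofPred_eq, isEigen_iff hq' f (hY s).1 (hY s).2.1 (hY s).2.2]
    simp [hE]
  obtain ⟨m, C, hC, hf⟩ := f.exists_eval_le
  obtain ⟨m', hm'⟩ := exists_forall_le_mul_deriv_nonneg hpi hq' hC
  have hDE : ∀ s ≤ min m m', 0 ≤ D s * E s := by
    intro s hs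
    obtain ⟨hpole, hle⟩ := hf s (hs.trans (min_le_left _ _))
    refine hm' s (hs.trans (min_le_right _ _)) _ _ (hY s).1 ?_
    rw [(hY s).2.1, (hY s).2.2, Pi.neg_apply, f.num_eq_eval_mul_den hpole]
    linarith [mul_le_mul_of_nonneg_right hle (sq_nonneg (f.den s))]
  have hK' : ∀ s t, E s * -D t - -D s * E t = (s - t) * K s t := fun s t => by
    rw [← hK]
    ring
  have hsym : {lam : ℝ | IsEigenSym q f lam} =
      eigenvalues q f none ∪ eigenvalues q f (some 0) := by
    ext s
    exact isEigenSym_iff hq' f s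
  rw [hsym] at hΛsym
  refine hΛzero.eq_of_interlacing hΛinf hΛsym ?_ ?_ ?_
  · intro t ht
    simp only [hzero, hinf] at ht ⊢
    obtain ⟨r, hr, hr'⟩ := exists_zero_lt_of_wronskian hEc hK' hKc hKpos
      (fun s hs => by simpa [mul_comm] using hDE s hs) (t := t) (by simpa using ht)
    exact ⟨r, hr', hr⟩
  · intro s hs t ht hst
    simp only [hzero, hinf] at hs ht ⊢
    obtain ⟨r, hr, hr'⟩ :=
      exists_zero_between_of_wronskian hDc hK hKc hKpos hst hs ht
    exact ⟨r, hr', hr⟩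
  · intro s hs t ht hst
    simp only [hzero, hinf] at hs ht ⊢
    obtain ⟨r, hr, hr'⟩ := exists_zero_between_of_wronskian hEc hK' hKc hKpos hst
      (by simpa using hs) (by simpa using ht)
    exact ⟨r, hr', hr⟩
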